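/- Let H be a Hopf algebra with invertible antipode and γ a 2-cocycle on H. The linear map Q : H → H, h ↦ h₍₃₎ u_γ(h₍₁₎) γ̄(S(h₍₂₎) ⊗ h₍₄₎), is bijective with inverse Q⁻¹ : h ↦ h₍₃₎ ū_γ(h₍₂₎) γ(S(h₍₁₎) ⊗ h₍₄₎). -/

import Mathlib

open TensorProduct LinearMap

noncomputable section

variable (R H : Type*) [CommRing R] [Ring H] [HopfAlgebra R H]

/-- The multiplication of `H` as a linear map. -/
abbrev mulH : H ⊗[R] H →ₗ[R] H := LinearMap.mul' R H

/-- The antipode of `H`. -/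
abbrev Sa : H →ₗ[R] H := HopfAlgebra.antipode (R := R)

/-- The comultiplication `h ⊗ k ↦ (h₍₁₎ ⊗ k₍₁₎) ⊗ (h₍₂₎ ⊗ k₍₂₎)` on `H ⊗ H`. -/
def comul2 : H ⊗[R] H →ₗ[R] (H ⊗[R] H) ⊗[R] (H ⊗[R] H) :=
  (tensorTensorTensorComm R H H H H).toLinearMap ∘ₗ map (Coalgebra.comul (R := R)) (Coalgebra.comul (R := R))

/-- The (Coalgebra.counit (R := R)) `h ⊗ k ↦ ε(h)ε(k)` on `H ⊗ H`. -/
def counit2 : H ⊗[R] H →ₗ[R] R :=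
  (TensorProduct.lid R R).toLinearMap ∘ₗ map (Coalgebra.counit (R := R)) (Coalgebra.counit (R := R))

/-- Iterated comultiplication `h ↦ (h₍₁₎ ⊗ h₍₂₎) ⊗ h₍₃₎`. -/
def comul3 : H →ₗ[R] (H ⊗[R] H) ⊗[R] H := map (Coalgebra.comul (R := R)) LinearMap.id ∘ₗ (Coalgebra.comul (R := R))

/-- Iterated comultiplication `h ↦ ((h₍₁₎ ⊗ h₍₂₎) ⊗ h₍₃₎) ⊗ h₍₄₎`. -/
def comul4 : H →ₗ[R] ((H ⊗[R] H) ⊗[R] H) ⊗[R] H := map (comul3 R H) LinearMap.id ∘ₗ (Coalgebra.comul (R := R))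

/-- Convolution product of two functionals with respect to a given comultiplication. -/
def convOn {C : Type*} [AddCommMonoid C] [Module R C]
    (Δc : C →ₗ[R] C ⊗[R] C) (f g : C →ₗ[R] R) : C →ₗ[R] R :=
  LinearMap.mul' R R ∘ₗ map f g ∘ₗ Δc

/-- The comultiplication on the triple tensor product `(H ⊗ H) ⊗ H`. -/
def comulC3 : (H ⊗[R] H) ⊗[R] H →ₗ[R] ((H ⊗[R] H) ⊗[R] H) ⊗[R] ((H ⊗[R] H) ⊗[R] H) :=
  (tensorTensorTensorComm R (H ⊗[R] H) (H ⊗[R] H) H H).toLinearMap ∘ₗ map (comul2 R H) (Coalgebra.comul (R := R))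

/-- `γ` is a 2-cocycle with convolution inverse `γ'` relative to the product `μ`:
convolution invertible, unital, and satisfying the 2-cocycle condition
`γ(g₍₁₎⊗h₍₁₎)γ(g₍₂₎h₍₂₎⊗k) = γ(h₍₁₎⊗k₍₁₎)γ(g⊗h₍₂₎k₍₂₎)`. -/
structure IsCocycle (μ : H ⊗[R] H →ₗ[R] H) (γ γ' : H ⊗[R] H →ₗ[R] R) : Prop where
  cocycle : convOn R (comulC3 R H) (LinearMap.mul' R R ∘ₗ map γ (Coalgebra.counit (R := R))) (γ ∘ₗ map μ LinearMap.id)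
    = convOn R (comulC3 R H)
        (LinearMap.mul' R R ∘ₗ map (Coalgebra.counit (R := R)) γ ∘ₗ (TensorProduct.assoc R H H H).toLinearMap)
        (γ ∘ₗ map LinearMap.id μ ∘ₗ (TensorProduct.assoc R H H H).toLinearMap)
  conv_inv_right : convOn R (comul2 R H) γ γ' = counit2 R H
  conv_inv_left : convOn R (comul2 R H) γ' γ = counit2 R H
  unital_right : ∀ h : H, γ (h ⊗ₜ[R] 1) = (Coalgebra.counit (R := R)) h
  unital_left : ∀ h : H, γ (1 ⊗ₜ[R] h) = (Coalgebra.counit (R := R)) h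

/-- The twisted product `h ·_γ k = γ(h₍₁₎⊗k₍₁₎) h₍₂₎∙k₍₂₎ γ'(h₍₃₎⊗k₍₃₎)`, where `∙` is
the (possibly already deformed) product `μ`. -/
def twistMul (μ : H ⊗[R] H →ₗ[R] H) (γ γ' : H ⊗[R] H →ₗ[R] R) : H ⊗[R] H →ₗ[R] H :=
  (TensorProduct.lid R H).toLinearMap ∘ₗ (TensorProduct.rid R (R ⊗[R] H)).toLinearMap
    ∘ₗ map (map γ μ) γ' ∘ₗ map (comul2 R H) LinearMap.id ∘ₗ comul2 R H

/-- `u_γ(h) = γ(h₍₁₎ ⊗ S(h₍₂₎))`. -/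
def uMap (γ : H ⊗[R] H →ₗ[R] R) : H →ₗ[R] R :=
  γ ∘ₗ map LinearMap.id (Sa R H) ∘ₗ (Coalgebra.comul (R := R))

/-- `ū_γ(h) = γ'(S(h₍₁₎) ⊗ h₍₂₎)`. -/
def ubarMap (γ' : H ⊗[R] H →ₗ[R] R) : H →ₗ[R] R :=
  γ' ∘ₗ map (Sa R H) LinearMap.id ∘ₗ (Coalgebra.comul (R := R))

/-- The twisted antipode `S_γ(h) = u_γ(h₍₁₎) S(h₍₂₎) ū_γ(h₍₃₎)`. -/
def Stw (γ γ' : H ⊗[R] H →ₗ[R] R) : H →ₗ[R] H :=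
  (TensorProduct.lid R H).toLinearMap ∘ₗ (TensorProduct.rid R (R ⊗[R] H)).toLinearMap
    ∘ₗ map (map (uMap R H γ) (Sa R H)) (ubarMap R H γ') ∘ₗ comul3 R H

/-- The (generalized) right adjoint coaction `h ↦ h₍₂₎ ⊗ S'(h₍₁₎) ∙ h₍₃₎`. -/
def AdGen (S' : H →ₗ[R] H) (μ : H ⊗[R] H →ₗ[R] H) : H →ₗ[R] H ⊗[R] H :=
  map LinearMap.id μ ∘ₗ (TensorProduct.assoc R H H H).toLinearMap
    ∘ₗ map ((TensorProduct.comm R H H).toLinearMap ∘ₗ map S' LinearMap.id) LinearMap.id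
    ∘ₗ comul3 R H

/-- The right adjoint coaction `Ad(h) = h₍₂₎ ⊗ S(h₍₁₎)h₍₃₎`. -/
def Ad : H →ₗ[R] H ⊗[R] H := AdGen R H (Sa R H) (mulH R H)

end

/-- `Q(h) = h₍₃₎ u_γ(h₍₁₎) γ̄(S(h₍₂₎) ⊗ h₍₄₎)`. -/
noncomputable def Qmap (R H : Type*) [CommRing R] [Ring H] [HopfAlgebra R H]
    (γ γ' : H ⊗[R] H →ₗ[R] R) : H →ₗ[R] H :=
  (TensorProduct.lid R H).toLinearMap ∘ₗ (TensorProduct.rid R (R ⊗[R] H)).toLinearMap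
    ∘ₗ map (map (uMap R H γ) LinearMap.id) (γ' ∘ₗ map (Sa R H) LinearMap.id)
    ∘ₗ (tensorTensorTensorComm R H H H H).toLinearMap
    ∘ₗ (TensorProduct.assoc R (H ⊗[R] H) H H).toLinearMap ∘ₗ comul4 R H

/-- `Q⁻¹(h) = h₍₃₎ ū_γ(h₍₂₎) γ(S(h₍₁₎) ⊗ h₍₄₎)`. -/
noncomputable def QinvMap (R H : Type*) [CommRing R] [Ring H] [HopfAlgebra R H]
    (γ γ' : H ⊗[R] H →ₗ[R] R) : H →ₗ[R] H :=
  (TensorProduct.lid R H).toLinearMap ∘ₗ (TensorProduct.lid R (R ⊗[R] H)).toLinearMap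
    ∘ₗ map (γ ∘ₗ map (Sa R H) LinearMap.id) (map (ubarMap R H γ') LinearMap.id)
    ∘ₗ (tensorTensorTensorComm R H H H H).toLinearMap
    ∘ₗ map LinearMap.id (TensorProduct.comm R H H).toLinearMap
    ∘ₗ (TensorProduct.assoc R (H ⊗[R] H) H H).toLinearMap ∘ₗ comul4 R H


open Coalgebra HopfAlgebra WithConv

noncomputable section

variable {R H : Type*} [CommRing R] [Ring H] [HopfAlgebra R H]

local notation "Δ" => (comul (R := R) (A := H))

/-- `h ↦ f(h₍₁₎) h₍₂₎`. -/
def leftContract (f : H →ₗ[R] R) : H →ₗ[R] H :=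
  (TensorProduct.lid R H).toLinearMap ∘ₗ map f .id ∘ₗ Δ

/-- `h ↦ ω(h₍₁₎ ⊗ h₍₃₎) h₍₂₎`. -/
def outerContract (ω : H ⊗[R] H →ₗ[R] R) : H →ₗ[R] H :=
  (TensorProduct.lid R H).toLinearMap ∘ₗ map ω .id ∘ₗ
    (TensorProduct.rightComm R H H H).toLinearMap ∘ₗ comul3 R H

theorem leftContract_counit : leftContract (counit (R := R) (A := H)) = .id := by
  ext a
  simp [leftContract, ← LinearMap.rTensor_def]

theorem leftContract_comp (f g : H →ₗ[R] R) :
    leftContract f ∘ₗ leftContract g = leftContract (convOn R Δ g f) := by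
  ext a
  let F : H ⊗[R] (H ⊗[R] H) →ₗ[R] H :=
    (TensorProduct.lid R H).toLinearMap ∘ₗ map g ((TensorProduct.lid R H).toLinearMap ∘ₗ map f .id)
  convert! congrArg F (coassoc_apply (R := R) a).symm using 1
  · simp only [leftContract, LinearMap.comp_apply, F]
    hopf_tensor_induction comul (R := R) a with x y
    simp
  · simp only [leftContract, LinearMap.comp_apply, F]
    hopf_tensor_induction comul (R := R) a with x y
    simp only [map_tmul, rTensor_tmul, convOn, LinearMap.comp_apply]
    hopf_tensor_induction comul (R := R) x with x z
    simp [smul_smul, mul_comm]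

theorem outerContract_counit2 : outerContract (counit2 R H) = .id := by
  ext a
  have key : (TensorProduct.rid R H).toLinearMap
      (map (leftContract (counit (R := R) (A := H))) (counit (R := R)) (comul (R := R) a)) = a := by
    simp [leftContract_counit, ← LinearMap.lTensor_def]
  rw [LinearMap.id_apply]
  conv_rhs => rw [← key]
  simp only [outerContract, comul3, leftContract, LinearMap.comp_apply]
  hopf_tensor_induction comul (R := R) a with x z
  simp only [map_tmul, LinearMap.comp_apply]
  hopf_tensor_induction comul (R := R) x with x y
  simp [counit2, smul_smul, mul_comm]

/-- Iterating `outerContract` corresponds to convolution over the coalgebra `Hᶜᵒᵖ ⊗ H`. -/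
theorem outerContract_comp (ω ω' : H ⊗[R] H →ₗ[R] R) :
    outerContract ω ∘ₗ outerContract ω' =
      outerContract (LinearMap.mul' R R ∘ₗ map ω ω' ∘ₗ
        (tensorTensorTensorComm R H H H H).toLinearMap ∘ₗ
          map ((TensorProduct.comm R H H).toLinearMap ∘ₗ Δ) Δ) := by
  ext a
  have key : map (map .id (comul3 R H)) .id ∘ₗ comul3 R H =
      map (map .id (TensorProduct.assoc R H H H).symm.toLinearMap ∘ₗ
          (TensorProduct.assoc R H H (H ⊗[R] H)).toLinearMap) .id ∘ₗ
        (TensorProduct.assoc R (H ⊗[R] H) (H ⊗[R] H) H).symm.toLinearMap ∘ₗ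
          map .id (TensorProduct.assoc R H H H).symm.toLinearMap ∘ₗ
        (TensorProduct.assoc R (H ⊗[R] H) H (H ⊗[R] H)).toLinearMap ∘ₗ
          map (map Δ .id) Δ ∘ₗ comul3 R H := by
    simp only [comul3, coassoc_simps]
  let F : (H ⊗[R] ((H ⊗[R] H) ⊗[R] H)) ⊗[R] H →ₗ[R] H :=
    (TensorProduct.lid R H).toLinearMap ∘ₗ
      map ω' ((TensorProduct.lid R H).toLinearMap ∘ₗ map ω .id ∘ₗ
        (TensorProduct.rightComm R H H H).toLinearMap) ∘ₗ
          (TensorProduct.rightComm R H _ H).toLinearMap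
  convert! congrArg F (LinearMap.congr_fun key a) using 1
  · simp only [outerContract, LinearMap.comp_apply, F]
    hopf_tensor_induction comul3 R H a with x z
    hopf_tensor_induction x with x y
    simp
  · simp only [outerContract, LinearMap.comp_apply, F]
    hopf_tensor_induction comul3 R H a with x z
    hopf_tensor_induction x with x y
    simp only [map_tmul, LinearEquiv.coe_coe, rightComm_tmul, LinearMap.comp_apply]
    hopf_tensor_induction comul (R := R) x with x x'
    hopf_tensor_induction comul (R := R) z with z z'
    simp [smul_smul]

theorem Qmap_eq (γ γ' : H ⊗[R] H →ₗ[R] R) :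
    Qmap R H γ γ' = outerContract (γ' ∘ₗ map (Sa R H) .id) ∘ₗ leftContract (uMap R H γ) := by
  ext a
  have key : (TensorProduct.assoc R H (H ⊗[R] H) H).toLinearMap ∘ₗ
      map (TensorProduct.assoc R H H H).toLinearMap .id ∘ₗ comul4 R H =
      map .id (comul3 R H) ∘ₗ Δ := by
    simp only [comul4, comul3, coassoc_simps]
  let F : H ⊗[R] ((H ⊗[R] H) ⊗[R] H) →ₗ[R] H :=
    (TensorProduct.lid R H).toLinearMap ∘ₗ
      map (uMap R H γ) ((TensorProduct.lid R H).toLinearMap ∘ₗ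
        map (γ' ∘ₗ map (Sa R H) .id) .id ∘ₗ (TensorProduct.rightComm R H H H).toLinearMap)
  convert! congrArg F (LinearMap.congr_fun key a) using 1
  · simp only [Qmap, LinearMap.comp_apply, F]
    hopf_tensor_induction comul4 R H a with x w
    hopf_tensor_induction x with x z
    hopf_tensor_induction x with x y
    simp [smul_smul, mul_comm]
  · simp only [outerContract, leftContract, LinearMap.comp_apply, F]
    hopf_tensor_induction comul (R := R) a with x y
    simp

theorem QinvMap_eq (γ γ' : H ⊗[R] H →ₗ[R] R) :
    QinvMap R H γ γ' = leftContract (ubarMap R H γ') ∘ₗ outerContract (γ ∘ₗ map (Sa R H) .id) := by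
  ext a
  have key : map (TensorProduct.assoc R H H H).toLinearMap .id ∘ₗ comul4 R H =
      map (map .id Δ) .id ∘ₗ comul3 R H := by
    simp only [comul4, comul3, coassoc_simps]
  let F : (H ⊗[R] (H ⊗[R] H)) ⊗[R] H →ₗ[R] H :=
    (TensorProduct.lid R H).toLinearMap ∘ₗ
      map (γ ∘ₗ map (Sa R H) .id)
        ((TensorProduct.lid R H).toLinearMap ∘ₗ map (ubarMap R H γ') .id) ∘ₗ
          (TensorProduct.rightComm R H _ H).toLinearMap
  convert! congrArg F (LinearMap.congr_fun key a) using 1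
  · simp only [QinvMap, LinearMap.comp_apply, F]
    hopf_tensor_induction comul4 R H a with x w
    hopf_tensor_induction x with x z
    hopf_tensor_induction x with x y
    simp [smul_smul, mul_comm]
  · simp only [outerContract, leftContract, LinearMap.comp_apply, F]
    hopf_tensor_induction comul3 R H a with x z
    hopf_tensor_induction x with x y
    simp

theorem comul_comp_antipode :
    Δ ∘ₗ Sa R H = (TensorProduct.comm R H H).toLinearMap ∘ₗ map (Sa R H) (Sa R H) ∘ₗ Δ := by
  apply toConv_injective
  apply left_inv_eq_right_inv (a := toConv Δ)
  · have h := algHom_comp_convMul_distrib (Bialgebra.comulAlgHom R H)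
      (toConv (Sa R H)) (toConv .id)
    rw [antipode_mul_id] at h
    apply ofConv_injective
    refine Eq.trans h.symm ?_
    ext a
    simp [LinearMap.convOne_def]
  · ext a
    have key : (TensorProduct.assoc R H (H ⊗[R] H) H).toLinearMap ∘ₗ
        map (TensorProduct.assoc R H H H).toLinearMap .id ∘ₗ
          (TensorProduct.assoc R (H ⊗[R] H) H H).symm.toLinearMap ∘ₗ map Δ Δ ∘ₗ Δ =
        map .id (map Δ .id ∘ₗ Δ) ∘ₗ Δ := by
      simp only [coassoc_simps]
    let F : H ⊗[R] ((H ⊗[R] H) ⊗[R] H) →ₗ[R] H ⊗[R] H :=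
      map (mulH R H ∘ₗ map .id (Sa R H)) (mulH R H ∘ₗ map .id (Sa R H)) ∘ₗ
        (TensorProduct.assoc R H H (H ⊗[R] H)).symm.toLinearMap ∘ₗ
          map .id (TensorProduct.comm R (H ⊗[R] H) H).toLinearMap
    have hF := congrArg F (LinearMap.congr_fun key a)
    trans (F ((map .id (map Δ .id ∘ₗ Δ) ∘ₗ Δ) a))
    · rw [← hF]
      simp only [convMul_apply, LinearMap.comp_apply, F]
      hopf_tensor_induction comul (R := R) a with x y
      simp only [map_tmul, LinearMap.comp_apply]
      hopf_tensor_induction comul (R := R) x with x x'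
      hopf_tensor_induction comul (R := R) y with y y'
      simp
    · have hmul (x d : H) (t : H ⊗[R] H) : F (x ⊗ₜ (t ⊗ₜ d)) =
          (x * Sa R H d) ⊗ₜ mulH R H (map .id (Sa R H) t) := by
        simp only [F, LinearMap.comp_apply]
        hopf_tensor_induction t with b c
        simp
      have hF (x y : H) : F (x ⊗ₜ (map Δ .id (comul (R := R) y))) = (x * Sa R H y) ⊗ₜ 1 := by
        have hy : (TensorProduct.lid R H).toLinearMap
            (map (counit (R := R)) .id (comul (R := R) y)) = y := by
          simp [← LinearMap.rTensor_def]
        conv_rhs => rw [← hy]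
        hopf_tensor_induction comul (R := R) y with b d
        simp [hmul, ← LinearMap.lTensor_def, Algebra.algebraMap_eq_smul_one, smul_tmul]
      trans mulH R H (map .id (Sa R H) (comul (R := R) a)) ⊗ₜ[R] (1 : H)
      · simp only [LinearMap.comp_apply]
        hopf_tensor_induction comul (R := R) a with x y
        simp [hF]
      · simp [← LinearMap.lTensor_def, Algebra.algebraMap_eq_smul_one, smul_tmul',
          Algebra.TensorProduct.one_def]

theorem toConv_comp_coalgHom_mul_eq_one {C D : Type*} [AddCommMonoid C] [Module R C] [Coalgebra R C]
    [AddCommMonoid D] [Module R D] [Coalgebra R D] (π : C →ₗc[R] D) {f g : D →ₗ[R] R}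
    (h : toConv f * toConv g = 1) :
    toConv (f ∘ₗ π.toLinearMap) * toConv (g ∘ₗ π.toLinearMap) = 1 := by
  apply ofConv_injective
  refine (convMul_comp_coalgHom_distrib (toConv f) (toConv g) π).symm.trans ?_
  rw [h]
  ext
  simp [LinearMap.convOne_def]

theorem toConv_mul_toConv_eq_one {f g : H ⊗[R] H →ₗ[R] R}
    (h : convOn R (comul2 R H) f g = counit2 R H) : toConv f * toConv g = 1 := by
  apply ofConv_injective
  refine Eq.trans h ?_
  ext
  simp [counit2, LinearMap.convOne_def, mul_comm]

theorem IsCocycle.unital_left_inv {γ γ' : H ⊗[R] H →ₗ[R] R}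
    (hco : IsCocycle R H (mulH R H) γ γ') (h : H) : γ' (1 ⊗ₜ h) = counit (R := R) h := by
  have h₁ := LinearMap.congr_fun hco.conv_inv_right (1 ⊗ₜ h)
  have h₂ : counit2 R H (1 ⊗ₜ h) = counit (R := R) h := by simp [counit2]
  rw [← h₂, ← h₁]
  have h₃ : (TensorProduct.lid R H).toLinearMap
      (map (counit (R := R)) .id (comul (R := R) h)) = h := by
    simp [← LinearMap.rTensor_def]
  conv_lhs => rw [← h₃]
  simp only [convOn, comul2, LinearMap.comp_apply, map_tmul, Bialgebra.comul_one,
    Algebra.TensorProduct.one_def]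
  hopf_tensor_induction comul (R := R) h with x y
  simp [hco.unital_left]

theorem IsCocycle.unital_right_inv {γ γ' : H ⊗[R] H →ₗ[R] R}
    (hco : IsCocycle R H (mulH R H) γ γ') (h : H) : γ' (h ⊗ₜ 1) = counit (R := R) h := by
  have h₁ := LinearMap.congr_fun hco.conv_inv_right (h ⊗ₜ 1)
  have h₂ : counit2 R H (h ⊗ₜ 1) = counit (R := R) h := by simp [counit2]
  rw [← h₂, ← h₁]
  have h₃ : (TensorProduct.lid R H).toLinearMap
      (map (counit (R := R)) .id (comul (R := R) h)) = h := by
    simp [← LinearMap.rTensor_def]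
  conv_lhs => rw [← h₃]
  simp only [convOn, comul2, LinearMap.comp_apply, map_tmul, Bialgebra.comul_one,
    Algebra.TensorProduct.one_def]
  hopf_tensor_induction comul (R := R) h with x y
  simp [hco.unital_right, ← smul_tmul']

variable (R H) in
/-- `(g ⊗ h) ⊗ k ↦ ε(k) g ⊗ h`. -/
def forgetRight : (H ⊗[R] H) ⊗[R] H →ₗc[R] H ⊗[R] H :=
  (Coalgebra.TensorProduct.rid R R (H ⊗[R] H)).toCoalgHom.comp
    (Coalgebra.TensorProduct.map (.id R _) (counitCoalgHom R H))

variable (R H) in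
/-- `(g ⊗ h) ⊗ k ↦ ε(g) h ⊗ k`. -/
def forgetLeft : (H ⊗[R] H) ⊗[R] H →ₗc[R] H ⊗[R] H :=
  (Coalgebra.TensorProduct.lid R (H ⊗[R] H)).toCoalgHom.comp
    ((Coalgebra.TensorProduct.map (counitCoalgHom R H) (.id R _)).comp
      (Coalgebra.TensorProduct.assoc R R H H H).toCoalgHom)

variable (R H) in
/-- `(g ⊗ h) ⊗ k ↦ gh ⊗ k`. -/
def mulTensorLeft : (H ⊗[R] H) ⊗[R] H →ₗc[R] H ⊗[R] H :=
  Coalgebra.TensorProduct.map (Bialgebra.mulCoalgHom R H) (.id R H)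

variable (R H) in
/-- `(g ⊗ h) ⊗ k ↦ g ⊗ hk`. -/
def mulTensorRight : (H ⊗[R] H) ⊗[R] H →ₗc[R] H ⊗[R] H :=
  (Coalgebra.TensorProduct.map (.id R H) (Bialgebra.mulCoalgHom R H)).comp
    (Coalgebra.TensorProduct.assoc R R H H H).toCoalgHom

@[simp]
theorem forgetRight_tmul (g h k : H) :
    forgetRight R H ((g ⊗ₜ h) ⊗ₜ k) = counit (R := R) k • (g ⊗ₜ h) := rfl

@[simp]
theorem forgetLeft_tmul (g h k : H) :
    forgetLeft R H ((g ⊗ₜ h) ⊗ₜ k) = counit (R := R) g • (h ⊗ₜ k) := rfl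

@[simp]
theorem mulTensorLeft_tmul (g h k : H) :
    mulTensorLeft R H ((g ⊗ₜ h) ⊗ₜ k) = (g * h) ⊗ₜ k := rfl

@[simp]
theorem mulTensorRight_tmul (g h k : H) :
    mulTensorRight R H ((g ⊗ₜ h) ⊗ₜ k) = g ⊗ₜ (h * k) := rfl

theorem IsCocycle.conv_eq {γ γ' : H ⊗[R] H →ₗ[R] R}
    (hco : IsCocycle R H (mulH R H) γ γ') :
    toConv (γ ∘ₗ (forgetRight R H).toLinearMap) * toConv (γ ∘ₗ (mulTensorLeft R H).toLinearMap) =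
      toConv (γ ∘ₗ (forgetLeft R H).toLinearMap) * toConv (γ ∘ₗ (mulTensorRight R H).toLinearMap) := by
  apply ofConv_injective
  convert! hco.cocycle using 1
  · change convOn R (comulC3 R H) _ _ = _
    congr 1
    ext
    simp [mul_comm]
  · change convOn R (comulC3 R H) _ _ = _
    congr 1
    ext
    simp

/-- `γ̄(h₍₁₎⊗k)γ(g⊗h₍₂₎) = γ(g₍₁₎⊗h₍₁₎k₍₁₎)γ̄(g₍₂₎h₍₂₎⊗k₍₂₎)`. -/
theorem IsCocycle.forgetLeft_mul_forgetRight {γ γ' : H ⊗[R] H →ₗ[R] R}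
    (hco : IsCocycle R H (mulH R H) γ γ') :
    toConv (γ' ∘ₗ (forgetLeft R H).toLinearMap) * toConv (γ ∘ₗ (forgetRight R H).toLinearMap) =
      toConv (γ ∘ₗ (mulTensorRight R H).toLinearMap) * toConv (γ' ∘ₗ (mulTensorLeft R H).toLinearMap) := by
  have hl := toConv_comp_coalgHom_mul_eq_one (forgetLeft R H) (toConv_mul_toConv_eq_one hco.conv_inv_left)
  have hr := toConv_comp_coalgHom_mul_eq_one (mulTensorLeft R H) (toConv_mul_toConv_eq_one hco.conv_inv_right)
  rw [← mul_one (toConv (γ ∘ₗ (forgetRight R H).toLinearMap)), ← hr,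
    ← mul_assoc _ _ (toConv (γ' ∘ₗ _)), hco.conv_eq, mul_assoc, ← mul_assoc, hl, one_mul]

/-- `γ̄(g⊗h₍₁₎)γ(h₍₂₎⊗k) = γ(g₍₁₎h₍₁₎⊗k₍₁₎)γ̄(g₍₂₎⊗h₍₂₎k₍₂₎)`. -/
theorem IsCocycle.forgetRight_mul_forgetLeft {γ γ' : H ⊗[R] H →ₗ[R] R}
    (hco : IsCocycle R H (mulH R H) γ γ') :
    toConv (γ' ∘ₗ (forgetRight R H).toLinearMap) * toConv (γ ∘ₗ (forgetLeft R H).toLinearMap) =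
      toConv (γ ∘ₗ (mulTensorLeft R H).toLinearMap) * toConv (γ' ∘ₗ (mulTensorRight R H).toLinearMap) := by
  have hl := toConv_comp_coalgHom_mul_eq_one (forgetRight R H) (toConv_mul_toConv_eq_one hco.conv_inv_left)
  have hr := toConv_comp_coalgHom_mul_eq_one (mulTensorRight R H) (toConv_mul_toConv_eq_one hco.conv_inv_right)
  rw [← mul_one (toConv (γ ∘ₗ (forgetLeft R H).toLinearMap)), ← hr,
    ← mul_assoc _ _ (toConv (γ' ∘ₗ _)), ← hco.conv_eq, mul_assoc, ← mul_assoc, hl, one_mul]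

variable (R H) in
/-- `h ↦ (h₍₁₎ ⊗ ((h₍₂₎ ⊗ h₍₃₎) ⊗ (h₍₄₎ ⊗ h₍₅₎))) ⊗ h₍₆₎`. -/
def comul6 : H →ₗ[R] (H ⊗[R] ((H ⊗[R] H) ⊗[R] (H ⊗[R] H))) ⊗[R] H :=
  map (map .id (map Δ Δ ∘ₗ Δ) ∘ₗ Δ) .id ∘ₗ Δ

theorem comul6_eq : comul6 R H =
    map (map .id ((TensorProduct.assoc R H H (H ⊗[R] H)).symm.toLinearMap)) .id ∘ₗ
    map (map .id (map .id (TensorProduct.assoc R H H H).toLinearMap)) .id ∘ₗ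
    map (TensorProduct.assoc R H H ((H ⊗[R] H) ⊗[R] H)).toLinearMap .id ∘ₗ
    (TensorProduct.assoc R (H ⊗[R] H) ((H ⊗[R] H) ⊗[R] H) H).symm.toLinearMap ∘ₗ
    map .id (TensorProduct.assoc R (H ⊗[R] H) H H).symm.toLinearMap ∘ₗ
    (TensorProduct.assoc R (H ⊗[R] H) (H ⊗[R] H) (H ⊗[R] H)).toLinearMap ∘ₗ
    map (map Δ Δ) Δ ∘ₗ comul3 R H := by
  simp only [comul6, comul3, coassoc_simps]

theorem comul6_contract {f : H →ₗ[R] R}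
    {F : (H ⊗[R] ((H ⊗[R] H) ⊗[R] (H ⊗[R] H))) ⊗[R] H →ₗ[R] R}
    (hF : ∀ x y z : H, F ((x ⊗ₜ map Δ Δ (comul (R := R) y)) ⊗ₜ z) =
      counit (R := R) x * f y * counit (R := R) z) (a : H) :
    F (comul6 R H a) = f a := by
  have h := congrArg f (LinearMap.congr_fun (outerContract_counit2 (R := R) (H := H)) a)
  rw [LinearMap.id_apply] at h
  rw [← h]
  simp only [comul6, outerContract, comul3, LinearMap.comp_apply]
  hopf_tensor_induction comul (R := R) a with x z
  simp only [map_tmul, LinearMap.comp_apply]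
  hopf_tensor_induction comul (R := R) x with x y
  simp [hF, counit2, mul_assoc, mul_comm (f y)]

variable (R H) in
/-- `(a ⊗ ((b ⊗ c) ⊗ (d ⊗ e))) ⊗ f ↦ ((a ⊗ d) ⊗ e) ⊗ ((b ⊗ c) ⊗ f)`. -/
def regroup : (H ⊗[R] ((H ⊗[R] H) ⊗[R] (H ⊗[R] H))) ⊗[R] H →ₗ[R]
    ((H ⊗[R] H) ⊗[R] H) ⊗[R] ((H ⊗[R] H) ⊗[R] H) :=
  map (TensorProduct.assoc R H H H).symm.toLinearMap .id ∘ₗ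
    (TensorProduct.assoc R (H ⊗[R] (H ⊗[R] H)) (H ⊗[R] H) H).toLinearMap ∘ₗ
      map ((TensorProduct.assoc R H (H ⊗[R] H) (H ⊗[R] H)).symm.toLinearMap ∘ₗ
        map .id (TensorProduct.comm R (H ⊗[R] H) (H ⊗[R] H)).toLinearMap) .id

@[simp]
theorem regroup_tmul (a b c d e f : H) :
    regroup R H ((a ⊗ₜ ((b ⊗ₜ c) ⊗ₜ (d ⊗ₜ e))) ⊗ₜ f) =
      ((a ⊗ₜ d) ⊗ₜ e) ⊗ₜ ((b ⊗ₜ c) ⊗ₜ f) := rfl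

theorem comul_antipode (a : H) : comul (R := R) (Sa R H a) =
    TensorProduct.comm R H H (map (Sa R H) (Sa R H) (comul (R := R) a)) :=
  LinearMap.congr_fun comul_comp_antipode a

theorem conv_apply_antipode_middle (p q : (H ⊗[R] H) ⊗[R] H →ₗ[R] R) (a : H) :
    (toConv p * toConv q).ofConv (map (map .id (Sa R H)) .id (comul3 R H a)) =
      (LinearMap.mul' R R ∘ₗ map (p ∘ₗ map (map .id (Sa R H)) .id)
        (q ∘ₗ map (map .id (Sa R H)) .id) ∘ₗ regroup R H) (comul6 R H a) := by
  rw [comul6_eq]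
  change LinearMap.mul' R R (map p q (comulC3 R H _)) = _
  simp only [comulC3, comul2, LinearMap.comp_apply]
  hopf_tensor_induction comul3 R H a with x z
  hopf_tensor_induction x with x y
  simp only [map_tmul, LinearMap.comp_apply, comul_antipode, LinearMap.id_apply]
  hopf_tensor_induction comul (R := R) x with x x'
  hopf_tensor_induction comul (R := R) y with y y'
  hopf_tensor_induction comul (R := R) z with z z'
  simp

theorem conv_apply_antipode_outer (p q : (H ⊗[R] H) ⊗[R] H →ₗ[R] R) (a : H) :
    (toConv p * toConv q).ofConv (map (map (Sa R H) .id) (Sa R H) (comul3 R H a)) =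
      (LinearMap.mul' R R ∘ₗ map (p ∘ₗ map (map (Sa R H) .id) (Sa R H))
        (q ∘ₗ map (map (Sa R H) .id) (Sa R H)) ∘ₗ
          (TensorProduct.comm R _ _).toLinearMap ∘ₗ regroup R H) (comul6 R H a) := by
  rw [comul6_eq]
  change LinearMap.mul' R R (map p q (comulC3 R H _)) = _
  simp only [comulC3, comul2, LinearMap.comp_apply]
  hopf_tensor_induction comul3 R H a with x z
  hopf_tensor_induction x with x y
  simp only [map_tmul, LinearMap.comp_apply, comul_antipode, LinearMap.id_apply]
  hopf_tensor_induction comul (R := R) x with x x'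
  hopf_tensor_induction comul (R := R) y with y y'
  hopf_tensor_induction comul (R := R) z with z z'
  simp

theorem map_comul_of_apply_comul {f g : H ⊗[R] H →ₗ[R] H}
    (hf : ∀ y, f (comul (R := R) y) = Algebra.linearMap R H (counit (R := R) y))
    (hg : ∀ y, g (comul (R := R) y) = Algebra.linearMap R H (counit (R := R) y)) (y : H) :
    map f g (map Δ Δ (comul (R := R) y)) =
      Algebra.linearMap R H (counit (R := R) y) ⊗ₜ[R] (1 : H) := by
  have hy : (TensorProduct.lid R H).toLinearMap
      (map (counit (R := R)) .id (comul (R := R) y)) = y := by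
    simp [← LinearMap.rTensor_def]
  conv_rhs => rw [← hy]
  hopf_tensor_induction comul (R := R) y with b d
  simp [hf, hg, Algebra.algebraMap_eq_smul_one, smul_tmul, smul_smul, mul_comm]

theorem mul_map_id_antipode_comul (y : H) : (mulH R H ∘ₗ map .id (Sa R H)) (comul (R := R) y) =
    Algebra.linearMap R H (counit (R := R) y) := by
  simp [← LinearMap.lTensor_def]

theorem mul_map_antipode_id_comul (y : H) : (mulH R H ∘ₗ map (Sa R H) .id) (comul (R := R) y) =
    Algebra.linearMap R H (counit (R := R) y) := by
  simp [← LinearMap.rTensor_def]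

theorem convOn_comp_comul (f g : H ⊗[R] H →ₗ[R] R) (y : H) :
    convOn R Δ (f ∘ₗ Δ) (g ∘ₗ Δ) y =
      LinearMap.mul' R R (map f g (map Δ Δ (comul (R := R) y))) := by
  rw [convOn, TensorProduct.map_comp]
  rfl

theorem IsCocycle.uMap_conv_ubarMap {γ γ' : H ⊗[R] H →ₗ[R] R}
    (hco : IsCocycle R H (mulH R H) γ γ') :
    convOn R Δ (uMap R H γ) (ubarMap R H γ') = counit (R := R) := by
  ext a
  have h := LinearMap.congr_fun (congrArg ofConv hco.forgetLeft_mul_forgetRight)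
    (map (map .id (Sa R H)) .id (comul3 R H a))
  rw [conv_apply_antipode_middle, conv_apply_antipode_middle] at h
  refine (comul6_contract (fun x y z ↦ ?_) a).symm.trans
    (h.trans (comul6_contract (fun x y z ↦ ?_) a))
  · rw [show uMap R H γ = (γ ∘ₗ map .id (Sa R H)) ∘ₗ Δ from rfl,
      show ubarMap R H γ' = (γ' ∘ₗ map (Sa R H) .id) ∘ₗ Δ from rfl, convOn_comp_comul]
    simp only [LinearMap.comp_apply]
    hopf_tensor_induction map Δ Δ (comul (R := R) y) with s t
    hopf_tensor_induction s with b c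
    hopf_tensor_induction t with d e
    simp
    ring
  · trans LinearMap.mul' R R (map (γ' ∘ₗ (TensorProduct.mk R H H).flip z)
      (γ ∘ₗ TensorProduct.mk R H H x)
        (map (mulH R H ∘ₗ map .id (Sa R H)) (mulH R H ∘ₗ map (Sa R H) .id)
          (map Δ Δ (comul (R := R) y))))
    · simp only [LinearMap.comp_apply]
      hopf_tensor_induction map Δ Δ (comul (R := R) y) with s t
      hopf_tensor_induction s with b c
      hopf_tensor_induction t with d e
      simp [mul_comm]
    · rw [map_comul_of_apply_comul mul_map_id_antipode_comul mul_map_antipode_id_comul]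
      simp [hco.unital_right, hco.unital_left_inv, Algebra.algebraMap_eq_smul_one, ← smul_tmul']
      ring

theorem IsCocycle.ubarMap_conv_uMap {γ γ' : H ⊗[R] H →ₗ[R] R}
    (hco : IsCocycle R H (mulH R H) γ γ') :
    convOn R Δ (ubarMap R H γ') (uMap R H γ) = counit (R := R) := by
  ext a
  have h := LinearMap.congr_fun (congrArg ofConv hco.forgetRight_mul_forgetLeft)
    (map (map (Sa R H) .id) (Sa R H) (comul3 R H a))
  rw [conv_apply_antipode_outer, conv_apply_antipode_outer] at h
  refine (comul6_contract (fun x y z ↦ ?_) a).symm.trans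
    (h.trans (comul6_contract (fun x y z ↦ ?_) a))
  · rw [show ubarMap R H γ' = (γ' ∘ₗ map (Sa R H) .id) ∘ₗ Δ from rfl,
      show uMap R H γ = (γ ∘ₗ map .id (Sa R H)) ∘ₗ Δ from rfl, convOn_comp_comul]
    simp only [LinearMap.comp_apply]
    hopf_tensor_induction map Δ Δ (comul (R := R) y) with s t
    hopf_tensor_induction s with b c
    hopf_tensor_induction t with d e
    simp
    ring
  · trans LinearMap.mul' R R (map (γ ∘ₗ (TensorProduct.mk R H H).flip (Sa R H z))
      (γ' ∘ₗ TensorProduct.mk R H H (Sa R H x))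
        (map (mulH R H ∘ₗ map (Sa R H) .id) (mulH R H ∘ₗ map .id (Sa R H))
          (map Δ Δ (comul (R := R) y))))
    · simp only [LinearMap.comp_apply]
      hopf_tensor_induction map Δ Δ (comul (R := R) y) with s t
      hopf_tensor_induction s with b c
      hopf_tensor_induction t with d e
      simp
    · rw [map_comul_of_apply_comul mul_map_antipode_id_comul mul_map_id_antipode_comul]
      simp [hco.unital_left, hco.unital_right_inv, Algebra.algebraMap_eq_smul_one, ← smul_tmul']
      ring

theorem outerContract_comp_eq_id {f g : H ⊗[R] H →ₗ[R] R}
    (h : convOn R (comul2 R H) f g = counit2 R H) :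
    outerContract (f ∘ₗ map (Sa R H) .id) ∘ₗ outerContract (g ∘ₗ map (Sa R H) .id) = .id := by
  rw [outerContract_comp]
  refine (congrArg outerContract ?_).trans outerContract_counit2
  ext a b
  have hab := LinearMap.congr_fun h (Sa R H a ⊗ₜ b)
  trans counit2 R H (Sa R H a ⊗ₜ b)
  · rw [← hab]
    simp only [convOn, comul2, LinearMap.comp_apply, map_tmul, comul_antipode,
      TensorProduct.AlgebraTensorModule.curry_apply, TensorProduct.curry_apply,
      LinearMap.restrictScalars_self]
    hopf_tensor_induction comul (R := R) a with x x'
    hopf_tensor_induction comul (R := R) b with y y'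
    simp
  · simp [counit2]

end

/-- `Q(h) = h₍₃₎ u_γ(h₍₁₎) γ̄(S(h₍₂₎)⊗h₍₄₎)` is bijective with inverse
`Q⁻¹(h) = h₍₃₎ ū_γ(h₍₂₎) γ(S(h₍₁₎)⊗h₍₄₎)`. -/
theorem Qmap_bijective (R H : Type*) [CommRing R] [Ring H] [HopfAlgebra R H]
    (hS : Function.Bijective (Sa R H))
    (γ γ' : H ⊗[R] H →ₗ[R] R) (hco : IsCocycle R H (mulH R H) γ γ') :
    (Qmap R H γ γ' ∘ₗ QinvMap R H γ γ' = LinearMap.id)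
    ∧ (QinvMap R H γ γ' ∘ₗ Qmap R H γ γ' = LinearMap.id)
    ∧ Function.Bijective (Qmap R H γ γ') := by
  have h₁ : Qmap R H γ γ' ∘ₗ QinvMap R H γ γ' = LinearMap.id := by
    rw [Qmap_eq, QinvMap_eq, LinearMap.comp_assoc, ← LinearMap.comp_assoc _ _ (leftContract _),
      leftContract_comp, hco.ubarMap_conv_uMap, leftContract_counit, LinearMap.id_comp,
      outerContract_comp_eq_id hco.conv_inv_left]
  have h₂ : QinvMap R H γ γ' ∘ₗ Qmap R H γ γ' = LinearMap.id := by
    rw [Qmap_eq, QinvMap_eq, LinearMap.comp_assoc, ← LinearMap.comp_assoc _ _ (outerContract _),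
      outerContract_comp_eq_id hco.conv_inv_right, LinearMap.id_comp, leftContract_comp,
      hco.uMap_conv_ubarMap, leftContract_counit]
  exact ⟨h₁, h₂, Function.bijective_iff_has_inverse.mpr
    ⟨QinvMap R H γ γ', LinearMap.congr_fun h₂, LinearMap.congr_fun h₁⟩⟩
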